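/- arXiv:1909.10210 — 7 statements merged into one kernel-verified Lean document; each statement's English description precedes it below -/
import Mathlib

section
/- Let k ≥ 3 be an integer and let R be an associative ring with 1 that is Lie nilpotent of index k. Then [x₁,x₂,…,x_k]_k · [y₁,y₂,…,y_k]_k = 0 for all elements x₁,…,x_k, y₁,…,y_k ∈ R. -/
/-- `lnc a [x₁,…,x_m]` is the left-normed commutator `[…[[a,x₁],x₂],…,x_m]`,
where `[a,b] = a*b - b*a`. -/
def lnc {R : Type*} [Ring R] : R → List R → R
  | a, [] => a
  | a, x :: l => lnc (a * x - x * a) l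

/-- `LNC k x` is the left-normed commutator `[x 0, x 1, …, x k]` of the `k+1`
elements `x 0, …, x k`. -/
def LNC {R : Type*} [Ring R] (k : ℕ) (x : ℕ → R) : R :=
  lnc (x 0) ((List.range k).map fun i => x (i + 1))

/-- A ring `R` is Lie nilpotent of index `k` if all left-normed commutators of
any `k+1` of its elements vanish. -/
def LieNilpotentOfIndex (R : Type*) [Ring R] (k : ℕ) : Prop :=
  ∀ x : ℕ → R, LNC k x = 0

theorem lnc_append {R : Type*} [Ring R] (a : R) (l l' : List R) :
    lnc a (l ++ l') = lnc (lnc a l) l' := by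
  induction l generalizing a with
  | nil => rfl
  | cons x l ih => exact ih _

theorem LNC_succ {R : Type*} [Ring R] (n : ℕ) (x : ℕ → R) :
    LNC (n + 1) x = LNC n x * x (n + 1) - x (n + 1) * LNC n x := by
  simp [LNC, List.range_succ, lnc_append, lnc]

theorem LNC_congr {R : Type*} [Ring R] {n : ℕ} {x y : ℕ → R} (h : ∀ i ≤ n, x i = y i) :
    LNC n x = LNC n y := by
  induction n with
  | zero => simpa [LNC, lnc] using h 0 le_rfl
  | succ n ih =>
    rw [LNC_succ, LNC_succ, ih fun i hi => h i (hi.trans n.le_succ), h _ le_rfl]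

/-- In a Lie nilpotent ring of index `n + 2`, commuting a left-normed commutator of
`n + 1` elements with two further elements gives zero. -/
theorem LieNilpotentOfIndex.lie_lie_LNC_eq_zero {R : Type*} [Ring R] {n : ℕ}
    (hL : LieNilpotentOfIndex R (n + 2)) (x : ℕ → R) (u v : R) :
    ⁅⁅LNC n x, u⁆, v⁆ = 0 := by
  have h := hL (Function.update (Function.update x (n + 1) u) (n + 2) v)
  rw [LNC_succ, LNC_succ, LNC_congr (y := x)] at h
  · simpa [Ring.lie_def] using h
  · intro i hi
    rw [Function.update_of_ne (by lia), Function.update_of_ne (by lia)]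

/-- If `⁅⁅a, u⁆, v⁆ = 0` for all `u` and `v`, then `a` commutes with every commutator. -/
theorem lie_lie_eq_zero_of_forall {R : Type*} [Ring R] {a : R}
    (ha : ∀ u v : R, ⁅⁅a, u⁆, v⁆ = 0) (b c : R) : ⁅a, ⁅b, c⁆⁆ = 0 := by
  calc ⁅a, ⁅b, c⁆⁆ = ⁅⁅a, b⁆, c⁆ - ⁅⁅a, c⁆, b⁆ := by simp only [Ring.lie_def]; noncomm_ring
    _ = 0 := by rw [ha, ha, sub_zero]

/-- If `⁅⁅a, u⁆, v⁆ = 0` for all `u` and `v`, and `a` commutes with `b`, then the products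
`⁅a, p⁆ * ⁅b, q⁆` vanish. -/
theorem lie_mul_lie_eq_zero_of_forall {R : Type*} [Ring R] {a b : R}
    (ha : ∀ u v : R, ⁅⁅a, u⁆, v⁆ = 0) (hab : ⁅a, b⁆ = 0) (p q : R) :
    ⁅a, p⁆ * ⁅b, q⁆ = 0 := by
  calc ⁅a, p⁆ * ⁅b, q⁆ = ⁅⁅a, p * b⁆, q⁆ - ⁅⁅a, p⁆, q⁆ * b - ⁅p * ⁅a, b⁆, q⁆ := by
        simp only [Ring.lie_def]; noncomm_ring
    _ = 0 := by simp [ha, hab, Ring.lie_def 0 q]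

/-- **Jennings' theorem.** If `k ≥ 3` and `R` is Lie nilpotent of index `k`, then the
product of any two left-normed commutators of `k` elements each is zero:
`[x₁,…,x_k]_k · [y₁,…,y_k]_k = 0`. -/
theorem jennings_product_of_leftNormedComm_eq_zero
    (k : ℕ) (hk : 3 ≤ k) (R : Type*) [Ring R] (hL : LieNilpotentOfIndex R k)
    (x y : ℕ → R) :
    LNC (k - 1) x * LNC (k - 1) y = 0 := by
  obtain ⟨m, rfl⟩ := Nat.exists_eq_add_of_le' hk
  have ha := hL.lie_lie_LNC_eq_zero x
  have hab : ⁅LNC (m + 1) x, LNC (m + 1) y⁆ = 0 := by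
    rw [LNC_succ m y, ← Ring.lie_def]
    exact lie_lie_eq_zero_of_forall ha _ _
  rw [show m + 3 - 1 = m + 1 + 1 from rfl, LNC_succ, LNC_succ (m + 1) y, ← Ring.lie_def,
    ← Ring.lie_def]
  exact lie_mul_lie_eq_zero_of_forall ha hab _ _
end

section
/- Let k ≥ 2 be an integer and let R be an associative ring with 1 that is Lie nilpotent of index k. Then the double commutator ideal D = R[[R,R],R]R is nilpotent with D^{2^{k−2}} = {0}; that is, for any elements d₁, d₂, …, d_{2^{k−2}} ∈ D, the product d₁d₂⋯d_{2^{k−2}} equals 0. -/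
/-- The set of left-normed commutators of `n + 1` elements of `R`. -/
def leftNormedCommutators (R : Type*) [Ring R] : ℕ → Set R
  | 0 => Set.univ
  | n + 1 => {v | ∃ u ∈ leftNormedCommutators R n, ∃ c, v = u * c - c * u}

theorem lnc_append_singleton {R : Type*} [Ring R] (a : R) (l : List R) (y : R) :
    lnc a (l ++ [y]) = lnc a l * y - y * lnc a l := by
  induction l generalizing a with
  | nil => rfl
  | cons x l ih => exact ih _

theorem exists_LNC_eq {R : Type*} [Ring R] {n : ℕ} {v : R}
    (hv : v ∈ leftNormedCommutators R n) : ∃ x : ℕ → R, LNC n x = v := by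
  induction n generalizing v with
  | zero => exact ⟨fun _ => v, rfl⟩
  | succ n ih =>
    obtain ⟨u, hu, c, rfl⟩ := hv
    obtain ⟨x, rfl⟩ := ih hu
    refine ⟨Function.update x (n + 1) c, ?_⟩
    rw [LNC_succ, Function.update_self]
    have h : LNC n (Function.update x (n + 1) c) = LNC n x :=
      LNC_congr fun i hi => Function.update_of_ne (by lia) _ _
    rw [h]

theorem LieNilpotentOfIndex.eq_zero_of_mem {R : Type*} [Ring R] {k n : ℕ}
    (hL : LieNilpotentOfIndex R k) (hn : k ≤ n) {v : R}
    (hv : v ∈ leftNormedCommutators R n) : v = 0 := by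
  induction n, hn using Nat.le_induction generalizing v with
  | base =>
    obtain ⟨x, rfl⟩ := exists_LNC_eq hv
    exact hL x
  | succ n _ ih =>
    obtain ⟨u, hu, c, rfl⟩ := hv
    simp [ih hu]

/-- If all `[[u, c], r]` lie in `I`, then so do all `[u, d] [[a, b], r]`. -/
theorem TwoSidedIdeal.commutator_mul_doubleCommutator_mem {R : Type*} [Ring R]
    (I : TwoSidedIdeal R) {u : R}
    (hu : ∀ c r, (u * c - c * u) * r - r * (u * c - c * u) ∈ I) (d a b r : R) :
    (u * d - d * u) * ((a * b - b * a) * r - r * (a * b - b * a)) ∈ I := by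
  set c := a * b - b * a with hc
  have huc : u * c - c * u ∈ I := by
    have h := I.sub_mem (hu a b) (hu b a)
    convert h using 1
    rw [hc]
    noncomm_ring
  have h := I.sub_mem (I.sub_mem (I.sub_mem (hu (d * c) r) (I.mul_mem_right _ c (hu d r)))
    (I.mul_mem_left (d * r - r * d) _ huc)) (I.mul_mem_left d _ (hu c r))
  convert h using 1
  noncomm_ring

theorem mul_mem_span_leftNormedCommutators_succ {R : Type*} [Ring R] {n : ℕ} (hn : 1 ≤ n)
    {e x : R} (he : e ∈ TwoSidedIdeal.span (leftNormedCommutators R n))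
    (hx : x ∈ TwoSidedIdeal.span
      {u : R | ∃ a b c : R, u = (a * b - b * a) * c - c * (a * b - b * a)}) :
    e * x ∈ TwoSidedIdeal.span (leftNormedCommutators R (n + 1)) := by
  set I := TwoSidedIdeal.span (leftNormedCommutators R (n + 1))
  obtain ⟨m, rfl⟩ := Nat.exists_eq_add_of_le' hn
  induction he using TwoSidedIdeal.span_induction generalizing x with
  | mem h hh =>
    have hI : ∀ r, h * r - r * h ∈ I := fun r => TwoSidedIdeal.subset_span ⟨h, hh, r, rfl⟩
    obtain ⟨u, hu, d, rfl⟩ := hh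
    have hu' : ∀ c r, (u * c - c * u) * r - r * (u * c - c * u) ∈ I := fun c r =>
      TwoSidedIdeal.subset_span ⟨_, ⟨u, hu, c, rfl⟩, r, rfl⟩
    induction hx using TwoSidedIdeal.span_induction with
    | mem g hg =>
      obtain ⟨a, b, c, rfl⟩ := hg
      exact I.commutator_mul_doubleCommutator_mem hu' d a b c
    | zero => simp
    | add y z _ _ hy hz => rw [mul_add]; exact I.add_mem hy hz
    | neg y _ hy => rw [mul_neg]; exact I.neg_mem hy
    | left_absorb r y _ hy =>
      have h := I.add_mem (I.mul_mem_left r _ hy) (I.mul_mem_right _ y (hI r))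
      convert h using 1
      noncomm_ring
    | right_absorb r y _ hy => rw [← mul_assoc]; exact I.mul_mem_right _ _ hy
  | zero => simp
  | add y z _ _ hy hz => rw [add_mul]; exact I.add_mem (hy hx) (hz hx)
  | neg y _ hy => rw [neg_mul]; exact I.neg_mem (hy hx)
  | left_absorb r y _ hy => rw [mul_assoc]; exact I.mul_mem_left _ _ (hy hx)
  | right_absorb r y _ hy =>
    rw [mul_assoc]
    exact hy (TwoSidedIdeal.mul_mem_left _ _ _ hx)

theorem prod_mem_span_leftNormedCommutators {R : Type*} [Ring R] (d : ℕ → R) (m : ℕ)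
    (hd : ∀ i < m + 1, d i ∈ TwoSidedIdeal.span
      {u : R | ∃ a b c : R, u = (a * b - b * a) * c - c * (a * b - b * a)}) :
    ((List.range (m + 1)).map d).prod ∈
      TwoSidedIdeal.span (leftNormedCommutators R (m + 2)) := by
  induction m with
  | zero =>
    have h : {u : R | ∃ a b c : R, u = (a * b - b * a) * c - c * (a * b - b * a)} ⊆
        leftNormedCommutators R 2 := by
      rintro _ ⟨a, b, c, rfl⟩
      exact ⟨_, ⟨a, trivial, b, rfl⟩, c, rfl⟩
    simpa using TwoSidedIdeal.span_mono h (hd 0 (by simp))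
  | succ m ih =>
    rw [List.range_succ, List.map_append, List.prod_append, List.map_singleton,
      List.prod_singleton]
    exact mul_mem_span_leftNormedCommutators_succ (by lia)
      (ih fun i hi => hd i (by lia)) (hd _ (by lia))

/-- If `R` is Lie nilpotent of index `k ≥ 2`, then the double commutator ideal
`D = R[[R,R],R]R` is nilpotent with `D^(2^(k-2)) = {0}`: any product of `2^(k-2)`
elements of `D` vanishes. -/
theorem prod_mem_doubleCommutatorIdeal_eq_zero
    (k : ℕ) (hk : 2 ≤ k) (R : Type*) [Ring R] (hL : LieNilpotentOfIndex R k)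
    (D : TwoSidedIdeal R)
    (hD : D = TwoSidedIdeal.span
      {u | ∃ a b c : R, u = (a * b - b * a) * c - c * (a * b - b * a)})
    (d : ℕ → R) (hd : ∀ i, i < 2 ^ (k - 2) → d i ∈ D) :
    ((List.range (2 ^ (k - 2))).map d).prod = 0 := by
  subst hD
  have hk' : k - 2 < 2 ^ (k - 2) := Nat.lt_two_pow_self
  obtain ⟨m, hm⟩ : ∃ m, 2 ^ (k - 2) = m + 1 := ⟨2 ^ (k - 2) - 1, by lia⟩
  rw [hm] at hd hk' ⊢
  have h := prod_mem_span_leftNormedCommutators d m hd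
  have hbot : TwoSidedIdeal.span (leftNormedCommutators R (m + 2)) ≤ ⊥ :=
    TwoSidedIdeal.span_le.2 fun v hv =>
      (TwoSidedIdeal.mem_bot R).2 (hL.eq_zero_of_mem (by lia) hv)
  exact (TwoSidedIdeal.mem_bot R).1 (hbot h)
end

section
/- Let R be an associative ring with 1, n ≥ 1, and A an n×n matrix over R. Then sdet(A) = tr(A·A*) = tr(A*·A), where tr denotes the sum of the diagonal entries. -/
/-- The symmetric determinant. -/
def sdet {R : Type*} [Ring R] {n : ℕ} (A : Matrix (Fin n) (Fin n) R) : R :=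
  ∑ α : Equiv.Perm (Fin n), ∑ β : Equiv.Perm (Fin n),
    ((Equiv.Perm.sign α * Equiv.Perm.sign β : ℤˣ) : ℤ) •
      (List.ofFn fun i => A (α i) (β i)).prod

/-- The symmetric adjoint. -/
def sadj {R : Type*} [Ring R] {n : ℕ} (A : Matrix (Fin (n + 1)) (Fin (n + 1)) R) :
    Matrix (Fin (n + 1)) (Fin (n + 1)) R :=
  fun r s => (-1 : R) ^ ((r : ℕ) + (s : ℕ)) * sdet (A.submatrix s.succAbove r.succAbove)

/-- The permutation sending `0` to `p` and acting as `e` from the successors to the complement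
of `p`, both identified with `Fin n` in increasing order. -/
def consPerm {n : ℕ} (p : Fin (n + 1)) (e : Equiv.Perm (Fin n)) :
    Equiv.Perm (Fin (n + 1)) :=
  p.cycleRange⁻¹ * Equiv.Perm.decomposeFin.symm (0, e)

theorem consPerm_zero {n : ℕ} (p : Fin (n + 1)) (e : Equiv.Perm (Fin n)) :
    consPerm p e 0 = p := by
  simp [consPerm, Equiv.Perm.inv_def, Fin.cycleRange_symm_zero]

theorem consPerm_succ {n : ℕ} (p : Fin (n + 1)) (e : Equiv.Perm (Fin n)) (i : Fin n) :
    consPerm p e i.succ = p.succAbove (e i) := by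
  simp [consPerm, Equiv.Perm.inv_def, Fin.cycleRange_symm_succ]

theorem sign_consPerm {n : ℕ} (p : Fin (n + 1)) (e : Equiv.Perm (Fin n)) :
    Equiv.Perm.sign (consPerm p e) = (-1) ^ (p : ℕ) * Equiv.Perm.sign e := by
  simp [consPerm, Fin.sign_cycleRange]

theorem consPerm_bijective (n : ℕ) :
    Function.Bijective fun x : Fin (n + 1) × Equiv.Perm (Fin n) => consPerm x.1 x.2 := by
  rw [Fintype.bijective_iff_injective_and_card]
  refine ⟨?_, by simp [Fintype.card_perm, Nat.factorial_succ]⟩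
  rintro ⟨p, e⟩ ⟨q, f⟩ h
  obtain rfl : p = q := by simpa [consPerm_zero] using congrArg (fun σ => σ 0) h
  simpa [consPerm] using h

theorem sum_perm_eq_sum_consPerm {M : Type*} [AddCommMonoid M] {n : ℕ}
    (f : Equiv.Perm (Fin (n + 1)) → M) :
    ∑ α, f α = ∑ p, ∑ e, f (consPerm p e) := by
  rw [← Fintype.sum_prod_type']
  exact ((consPerm_bijective n).sum_comp f).symm

theorem sdet_eq_sum_consPerm {R : Type*} [Ring R] {n : ℕ}
    (A : Matrix (Fin (n + 1)) (Fin (n + 1)) R) (ρ : Equiv.Perm (Fin (n + 1))) :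
    sdet A = ∑ p : Fin (n + 1), ∑ q : Fin (n + 1), (-1 : ℤ) ^ ((p : ℕ) + (q : ℕ)) •
      ∑ a : Equiv.Perm (Fin n), ∑ b : Equiv.Perm (Fin n),
        ((Equiv.Perm.sign a * Equiv.Perm.sign b : ℤˣ) : ℤ) •
          (List.ofFn fun i => A (consPerm p a (ρ i)) (consPerm q b (ρ i))).prod := by
  have key : sdet A = ∑ α : Equiv.Perm (Fin (n + 1)), ∑ β : Equiv.Perm (Fin (n + 1)),
      ((Equiv.Perm.sign α * Equiv.Perm.sign β : ℤˣ) : ℤ) •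
        (List.ofFn fun i => A (α (ρ i)) (β (ρ i))).prod := by
    rw [sdet, ← Equiv.sum_comp (Equiv.mulRight ρ)]
    refine Finset.sum_congr rfl fun α _ => ?_
    rw [← Equiv.sum_comp (Equiv.mulRight ρ)]
    refine Finset.sum_congr rfl fun β _ => ?_
    simp only [Equiv.coe_mulRight, Equiv.Perm.sign_mul, Equiv.Perm.mul_apply]
    rw [mul_mul_mul_comm, Int.units_mul_self, mul_one]
  rw [key, sum_perm_eq_sum_consPerm]
  refine Finset.sum_congr rfl fun p _ => ?_
  simp_rw [sum_perm_eq_sum_consPerm (n := n)]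
  rw [Finset.sum_comm]
  refine Finset.sum_congr rfl fun q _ => ?_
  simp_rw [Finset.smul_sum, smul_smul, sign_consPerm]
  refine Finset.sum_congr rfl fun a _ => Finset.sum_congr rfl fun b _ => ?_
  congr 1
  push_cast
  ring

theorem neg_one_pow_mul_eq_zsmul {R : Type*} [Ring R] (k : ℕ) (x : R) :
    (-1 : R) ^ k * x = (-1 : ℤ) ^ k • x := by
  simp [zsmul_eq_mul]

/-- Expansion of the symmetric determinant along the first factor of each product. -/
theorem sdet_eq_sum_mul_sdet {R : Type*} [Ring R] {n : ℕ}
    (A : Matrix (Fin (n + 1)) (Fin (n + 1)) R) :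
    sdet A = ∑ p : Fin (n + 1), ∑ q : Fin (n + 1), (-1 : ℤ) ^ ((p : ℕ) + (q : ℕ)) •
      (A p q * sdet (A.submatrix p.succAbove q.succAbove)) := by
  rw [sdet_eq_sum_consPerm A 1]
  simp only [sdet, List.ofFn_succ, List.prod_cons, Equiv.Perm.one_apply, consPerm_zero,
    consPerm_succ, Finset.mul_sum, mul_smul_comm, Matrix.submatrix_apply]

/-- Expansion of the symmetric determinant along the last factor of each product. -/
theorem sdet_eq_sum_sdet_mul {R : Type*} [Ring R] {n : ℕ}
    (A : Matrix (Fin (n + 1)) (Fin (n + 1)) R) :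
    sdet A = ∑ p : Fin (n + 1), ∑ q : Fin (n + 1), (-1 : ℤ) ^ ((p : ℕ) + (q : ℕ)) •
      (sdet (A.submatrix p.succAbove q.succAbove) * A p q) := by
  rw [sdet_eq_sum_consPerm A (finRotate (n + 1))]
  simp only [sdet, List.ofFn_succ_last, Finset.sum_mul,
    List.prod_append, List.prod_singleton, consPerm_zero, smul_mul_assoc, Matrix.submatrix_apply,
    finRotate_apply, Fin.coeSucc_eq_succ, consPerm_succ, Fin.last_add_one]

/-- For an `n×n` matrix `A` (`n ≥ 1`) over a ring `R`,
`sdet(A) = tr(A·A*) = tr(A*·A)`. -/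
theorem sdet_eq_trace_mul_sadj
    (R : Type*) [Ring R] (n : ℕ) (A : Matrix (Fin (n + 1)) (Fin (n + 1)) R) :
    sdet A = (A * sadj A).trace ∧ sdet A = (sadj A * A).trace := by
  constructor
  · rw [sdet_eq_sum_mul_sdet]
    simp only [Matrix.trace, Matrix.diag_apply, Matrix.mul_apply, sadj, neg_one_pow_mul_eq_zsmul,
      mul_smul_comm]
    simp only [add_comm]
  · rw [sdet_eq_sum_sdet_mul, Finset.sum_comm]
    simp only [Matrix.trace, Matrix.diag_apply, Matrix.mul_apply, sadj, neg_one_pow_mul_eq_zsmul,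
      smul_mul_assoc]
    simp only [add_comm]
end

section
/- Let R be an associative ring with 1 in which 2·1 is invertible, and suppose R satisfies the identity [[x,y],z] = 0 (Lie nilpotency of index 2). Then for every 2×2 matrix A over R the following trace identity holds: I₂·( (1/2)tr(A)⁴ + (1/2)tr(A²)² + (1/4)tr(A)²·tr(A²) − (5/4)tr(A²)·tr(A)² + [tr(A³),tr(A)] ) + A·( tr(A)tr(A²) + tr(A²)tr(A) − 2tr(A)³ ) + A²·( 4tr(A)² − 2tr(A²) ) − A³·( 4tr(A) ) + 2A⁴ = 0, where for λ ∈ R the notation M·λ means the product of M with the scalar matrix λ·I₂, tr denotes the sum of the diagonal entries, and [a,b] = ab − ba. -/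
section

variable {K R : Type*} [CommRing K] [Ring R] [Algebra K R]

/-- Reassociated form of a commutation rule `y x = x y - u` with `u` a scalar. -/
lemma mul_mul_swap_of_scalar_commutator {x y : R} {u : K} (h : y * x = x * y - u • (1 : R))
    (z : R) : y * (x * z) = x * (y * z) - u • z := by
  rw [← mul_assoc, h, sub_mul, mul_assoc, smul_one_mul]

set_option maxHeartbeats 4000000 in
/-- The first row of the trace identity, over an algebra in which the commutators are scalars
`κ x y` satisfying the relations forced by Lie nilpotency of index 2. -/
lemma trace_identity_first_row {half : K} (h2 : 2 * half = 1) (κ : R → R → K)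
    (hκ : ∀ x y, κ x y • (1 : R) = x * y - y * x) (hanti : ∀ x y, κ y x = -κ x y)
    (hzero : ∀ x y z, κ x y * κ x z = 0)
    (hexch : ∀ x y z w, κ x z * κ w y + κ x y * κ w z = 0)
    {a b c d a₂ b₂ c₂ d₂ a₃ b₃ d₃ t s q : R}
    (ha₂ : a₂ = a * a + b * c) (hb₂ : b₂ = a * b + b * d)
    (hc₂ : c₂ = c * a + d * c) (hd₂ : d₂ = c * b + d * d)
    (ha₃ : a₃ = a₂ * a + b₂ * c) (hb₃ : b₃ = a₂ * b + b₂ * d) (hd₃ : d₃ = c₂ * b + d₂ * d)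
    (ht : t = a + d) (hs : s = a₂ + d₂) (hq : q = a₃ + d₃) :
    half • t ^ 4 + half • s ^ 2 + (half * half) • (t ^ 2 * s)
        - (5 * half * half) • (s * t ^ 2) + (q * t - t * q)
        + a * (t * s + s * t - (2 : K) • t ^ 3) + a₂ * ((4 : K) • t ^ 2 - (2 : K) • s)
        - a₃ * ((4 : K) • t) + (2 : K) • (a₃ * a + b₃ * c) = 0 ∧
      b * (t * s + s * t - (2 : K) • t ^ 3) + b₂ * ((4 : K) • t ^ 2 - (2 : K) • s)
        - b₃ * ((4 : K) • t) + (2 : K) • (a₃ * b + b₃ * d) = 0 := by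
  have hswap (x y : R) : y * x = x * y - κ x y • (1 : R) := by rw [hκ]; abel
  have hab := hswap a b
  have hac := hswap a c
  have had := hswap a d
  have hbc := hswap b c
  have hbd := hswap b d
  have hcd := hswap c d
  have huv := hzero a b c
  have huw := hzero a b d
  have hvw := hzero a c d
  have huu := hzero a b b
  have hvv := hzero a c c
  have hww := hzero a d d
  have hxx := hzero b c c
  have hyy := hzero b d d
  have hzz := hzero c d d
  have hxy := hzero b c d
  have hux : κ a b * κ b c = 0 := by linear_combination -hzero b a c + κ b c * hanti a b
  have huy : κ a b * κ b d = 0 := by linear_combination -hzero b a d + κ b d * hanti a b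
  have hvx : κ a c * κ b c = 0 := by
    linear_combination hzero c a b - κ c b * hanti a c + κ a c * hanti b c
  have hvz : κ a c * κ c d = 0 := by linear_combination -hzero c a d + κ c d * hanti a c
  have hxz : κ b c * κ c d = 0 := by linear_combination -hzero c b d + κ c d * hanti b c
  have hwy : κ a d * κ b d = 0 := by
    linear_combination hzero d a b - κ d b * hanti a d + κ a d * hanti b d
  have hwz : κ a d * κ c d = 0 := by
    linear_combination hzero d a c - κ d c * hanti a d + κ a d * hanti c d
  have hyz : κ b d * κ c d = 0 := by
    linear_combination hzero d b c - κ d c * hanti b d + κ b d * hanti c d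
  have hwx : κ a d * κ b c = κ a b * κ c d := by
    linear_combination -hexch a d b c + κ a d * hanti b c
  have hvy : κ a c * κ b d = -(κ a b * κ c d) := by
    linear_combination hexch a d c b - hwx
  have hab' := mul_mul_swap_of_scalar_commutator hab
  have hac' := mul_mul_swap_of_scalar_commutator hac
  have had' := mul_mul_swap_of_scalar_commutator had
  have hbc' := mul_mul_swap_of_scalar_commutator hbc
  have hbd' := mul_mul_swap_of_scalar_commutator hbd
  have hcd' := mul_mul_swap_of_scalar_commutator hcd
  generalize κ a b = u, κ a c = v, κ a d = w, κ b c = x, κ b d = y, κ c d = z at *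
  clear hκ hanti hzero hexch hswap
  subst hq ht hs ha₃ hb₃ hd₃ ha₂ hb₂ hc₂ hd₂
  constructor
  all_goals
    simp only [pow_succ, pow_zero, one_mul, mul_one, mul_add, add_mul, mul_sub, sub_mul,
      mul_assoc, mul_smul_comm, smul_mul_assoc, hab, hac, had, hbc, hbd, hcd,
      hab', hac', had', hbc', hbd', hcd']
    match_scalars
    all_goals grind

end

/-- The exchange relation for commutators in a Lie nilpotent ring of index 2. -/
lemma commutator_mul_commutator_add {R : Type*} [Ring R]
    (hL : ∀ x y z : R, (x * y - y * x) * z - z * (x * y - y * x) = 0) (x y z w : R) :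
    (x * z - z * x) * (w * y - y * w) + (x * y - y * x) * (w * z - z * w) = 0 := by
  have h : (x * z - z * x) * (w * y - y * w) + (x * y - y * x) * (w * z - z * w) =
      ((x * w) * y - y * (x * w)) * z - z * ((x * w) * y - y * (x * w))
        - x * ((w * y - y * w) * z - z * (w * y - y * w))
        - ((x * y - y * x) * z - z * (x * y - y * x)) * w := by
    noncomm_ring
  rw [h, hL, hL, hL, mul_zero, zero_mul, sub_zero, sub_zero]

/-- A two-sided inverse of `2` is central. -/
lemma half_mem_center {R : Type*} [Ring R] {half : R} (h2 : 2 * half = 1)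
    (h2' : half * 2 = 1) : half ∈ Subring.center R := by
  refine Subring.mem_center_iff.2 fun x => ?_
  calc x * half = half * 2 * x * half := by rw [h2', one_mul]
    _ = half * x * (2 * half) := by noncomm_ring
    _ = half * x := by rw [h2, mul_one]

/-- The first row of the trace identity in a Lie nilpotent ring of index 2. -/
lemma trace_identity_first_row_of_lieNilpotent {R : Type*} [Ring R] {half : R}
    (h2 : 2 * half = 1) (h2' : half * 2 = 1)
    (hL : ∀ x y z : R, (x * y - y * x) * z - z * (x * y - y * x) = 0)
    {a b c d a₂ b₂ c₂ d₂ a₃ b₃ d₃ t s q : R}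
    (ha₂ : a₂ = a * a + b * c) (hb₂ : b₂ = a * b + b * d)
    (hc₂ : c₂ = c * a + d * c) (hd₂ : d₂ = c * b + d * d)
    (ha₃ : a₃ = a₂ * a + b₂ * c) (hb₃ : b₃ = a₂ * b + b₂ * d) (hd₃ : d₃ = c₂ * b + d₂ * d)
    (ht : t = a + d) (hs : s = a₂ + d₂) (hq : q = a₃ + d₃) :
    half * t ^ 4 + half * s ^ 2 + half * half * t ^ 2 * s
        - 5 * half * half * (s * t ^ 2) + (q * t - t * q)
        + a * (t * s + s * t - 2 * t ^ 3) + a₂ * (4 * t ^ 2 - 2 * s)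
        - a₃ * (4 * t) + (a₃ * a + b₃ * c) * 2 = 0 ∧
      b * (t * s + s * t - 2 * t ^ 3) + b₂ * (4 * t ^ 2 - 2 * s)
        - b₃ * (4 * t) + (a₃ * b + b₃ * d) * 2 = 0 := by
  let κ (x y : R) : Subring.center R :=
    ⟨x * y - y * x, Subring.mem_center_iff.2 fun z => (sub_eq_zero.1 (hL x y z)).symm⟩
  let h : Subring.center R := ⟨half, half_mem_center h2 h2'⟩
  have hh : 2 * h = 1 := Subtype.ext h2
  have hexch (x y z w : R) : κ x z * κ w y + κ x y * κ w z = 0 :=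
    Subtype.ext (commutator_mul_commutator_add hL x y z w)
  have hzero (x y z : R) : κ x y * κ x z = 0 := by
    linear_combination h * hexch x y z x - κ x y * κ x z * hh
  have key := trace_identity_first_row hh κ
    (fun x y => mul_one (x * y - y * x)) (fun x y => Subtype.ext (neg_sub _ _).symm)
    hzero hexch ha₂ hb₂ hc₂ hd₂ ha₃ hb₃ hd₃ ht hs hq
  have halg : algebraMap (Subring.center R) R h = half := rfl
  simp only [Algebra.smul_def, map_mul, map_ofNat, halg] at key
  refine ⟨?_, ?_⟩
  · rw [← key.1]; noncomm_ring
  · rw [← key.2]; noncomm_ring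


/-- **Domokos' trace form of the Cayley–Hamilton identity.** If `1/2 ∈ R` (witnessed by
`half`) and `R` is Lie nilpotent of index 2 (i.e. `[[x,y],z] = 0`), then every `2×2`
matrix `A` over `R` satisfies
`I₂((1/2)tr⁴(A) + (1/2)tr²(A²) + (1/4)tr²(A)tr(A²) − (5/4)tr(A²)tr²(A) + [tr(A³),tr(A)])`
`+ A(tr(A)tr(A²) + tr(A²)tr(A) − 2tr³(A)) + A²(4tr²(A) − 2tr(A²)) − A³(4tr(A)) + 2A⁴ = 0`,
where `M·λ` denotes the product of `M` with the scalar matrix `λ·I₂`. -/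
theorem domokos_trace_cayleyHamilton
    (R : Type*) [Ring R] (half : R) (h2 : 2 * half = 1) (h2' : half * 2 = 1)
    (hL : ∀ x y z : R, (x * y - y * x) * z - z * (x * y - y * x) = 0)
    (A : Matrix (Fin 2) (Fin 2) R) :
    (1 : Matrix (Fin 2) (Fin 2) R) *
        ((half * A.trace ^ 4 + half * (A ^ 2).trace ^ 2
            + half * half * A.trace ^ 2 * (A ^ 2).trace
            - 5 * half * half * ((A ^ 2).trace * A.trace ^ 2)
            + ((A ^ 3).trace * A.trace - A.trace * (A ^ 3).trace)) •
          (1 : Matrix (Fin 2) (Fin 2) R))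
      + A * ((A.trace * (A ^ 2).trace + (A ^ 2).trace * A.trace - 2 * A.trace ^ 3) •
          (1 : Matrix (Fin 2) (Fin 2) R))
      + A ^ 2 * ((4 * A.trace ^ 2 - 2 * (A ^ 2).trace) • (1 : Matrix (Fin 2) (Fin 2) R))
      - A ^ 3 * ((4 * A.trace) • (1 : Matrix (Fin 2) (Fin 2) R))
      + A ^ 4 * ((2 : R) • (1 : Matrix (Fin 2) (Fin 2) R)) = 0 := by
  have h2e (i j) : (A ^ 2) i j = A i 0 * A 0 j + A i 1 * A 1 j := by
    rw [pow_two, Matrix.mul_apply, Fin.sum_univ_two]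
  have h3e (i j) : (A ^ 3) i j = (A ^ 2) i 0 * A 0 j + (A ^ 2) i 1 * A 1 j := by
    rw [pow_succ, Matrix.mul_apply, Fin.sum_univ_two]
  have h4e (i j) : (A ^ 4) i j = (A ^ 3) i 0 * A 0 j + (A ^ 3) i 1 * A 1 j := by
    rw [pow_succ, Matrix.mul_apply, Fin.sum_univ_two]
  have key₁ := trace_identity_first_row_of_lieNilpotent h2 h2' hL
    (h2e 0 0) (h2e 0 1) (h2e 1 0) (h2e 1 1) (h3e 0 0) (h3e 0 1) (h3e 1 1)
    A.trace_fin_two (A ^ 2).trace_fin_two (A ^ 3).trace_fin_two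
  have key₂ := trace_identity_first_row_of_lieNilpotent h2 h2' hL
    ((h2e 1 1).trans (add_comm _ _)) ((h2e 1 0).trans (add_comm _ _))
    ((h2e 0 1).trans (add_comm _ _)) ((h2e 0 0).trans (add_comm _ _))
    ((h3e 1 1).trans (add_comm _ _)) ((h3e 1 0).trans (add_comm _ _))
    ((h3e 0 0).trans (add_comm _ _)) (A.trace_fin_two.trans (add_comm _ _))
    ((A ^ 2).trace_fin_two.trans (add_comm _ _)) ((A ^ 3).trace_fin_two.trans (add_comm _ _))
  rw [add_comm ((A ^ 3) 1 1 * _), add_comm ((A ^ 3) 1 1 * _), ← h4e, ← h4e] at key₂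
  rw [← h4e, ← h4e] at key₁
  ext i j
  fin_cases i <;> fin_cases j <;>
    simp only [Fin.zero_eta, Fin.mk_one, Fin.isValue, one_mul, Matrix.sub_apply, Matrix.add_apply,
      Matrix.mul_apply, Fin.sum_univ_two, Matrix.smul_apply, Matrix.one_apply_eq,
      Matrix.one_apply_ne zero_ne_one, Matrix.one_apply_ne one_ne_zero, smul_eq_mul, mul_one,
      mul_zero, add_zero, zero_add, Matrix.zero_apply]
  · exact key₁.1
  · exact key₁.2
  · exact key₂.2
  · exact key₂.1
end

section
/- Let R be an associative ring with 1 in which 2·1 is invertible, and suppose R satisfies the identity [[x,y],z] = 0 (Lie nilpotency of index 2). Then for every 2×2 matrix A over R, if tr(A) = 0 and tr(A²) = 0, then A⁴ = 0. -/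
/-- In a Lie nilpotent ring of index 2, `[x, y] [y, z] = 0`. -/
theorem commutator_mul_commutator_eq_zero {R : Type*} [Ring R]
    (hL : ∀ x y z : R, (x * y - y * x) * z - z * (x * y - y * x) = 0) (x y z : R) :
    (x * y - y * x) * (y * z - z * y) = 0 := by
  have h : (x * y - y * x) * (y * z - z * y) =
      ((x * y) * z - z * (x * y)) * y - y * ((x * y) * z - z * (x * y))
        - x * ((y * z - z * y) * y - y * (y * z - z * y))
        - ((x * z - z * x) * y - y * (x * z - z * x)) * y := by
    noncomm_ring
  rw [h, hL, hL, hL]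
  simp

/-- If `1/2 ∈ R` and `R` is Lie nilpotent of index 2 (i.e. `[[x,y],z] = 0`), then for a
`2×2` matrix `A` over `R`, `tr(A) = tr(A²) = 0` implies `A⁴ = 0`. -/
theorem pow_four_eq_zero_of_traces_eq_zero
    (R : Type*) [Ring R] (h2 : IsUnit (2 : R))
    (hL : ∀ x y z : R, (x * y - y * x) * z - z * (x * y - y * x) = 0)
    (A : Matrix (Fin 2) (Fin 2) R)
    (h1 : A.trace = 0) (hsq : (A ^ 2).trace = 0) :
    A ^ 4 = 0 := by
  obtain ⟨a, b, c, d, rfl⟩ : ∃ a b c d, A = !![a, b; c, d] := ⟨_, _, _, _, Matrix.eta_fin_two A⟩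
  obtain rfl : d = -a := by
    rw [Matrix.trace_fin_two_of] at h1
    exact (neg_eq_of_add_eq_zero_right h1).symm
  obtain ⟨p, hp⟩ : ∃ p, p = a * a + b * c := ⟨_, rfl⟩
  have hA : !![a, b; c, -a] ^ 2 = !![p, a * b - b * a; c * a - a * c, c * b + a * a] := by
    rw [pow_two, Matrix.mul_fin_two, hp]
    congr! 3 <;> noncomm_ring
  rw [hA, Matrix.trace_fin_two_of] at hsq
  have hq : c * b + a * a = -p := (neg_eq_of_add_eq_zero_right hsq).symm
  have hpu : 2 * p = b * c - c * b := by
    rw [two_mul]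
    nth_rw 2 [← neg_neg p]
    rw [← hq, hp]
    abel
  have hpp : p * p = 0 := by
    have h : 2 * (2 * (p * p)) = 0 := by
      calc 2 * (2 * (p * p)) = (2 * p) * (2 * p) := by noncomm_ring
        _ = -((b * c - c * b) * (c * b - b * c)) := by rw [hpu]; noncomm_ring
        _ = 0 := by rw [commutator_mul_commutator_eq_zero hL, neg_zero]
    rwa [h2.mul_right_eq_zero, h2.mul_right_eq_zero] at h
  have hvw : (a * b - b * a) * (c * a - a * c) = 0 := by
    have h := commutator_mul_commutator_eq_zero hL b a c
    rwa [← neg_sub (a * b), ← neg_sub (c * a), neg_mul_neg] at h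
  have hwv : (c * a - a * c) * (a * b - b * a) = 0 := commutator_mul_commutator_eq_zero hL c a b
  have hv := hL a b p
  have hw := hL c a p
  rw [show 4 = 2 * 2 from rfl, pow_mul, hA, hq, pow_two, Matrix.mul_fin_two, hpp, hvw, hwv,
    neg_mul_neg, hpp, mul_neg, neg_mul, ← sub_eq_add_neg, ← sub_eq_add_neg, hw,
    ← neg_sub ((a * b - b * a) * p), hv]
  ext i j
  fin_cases i <;> fin_cases j <;> simp
end

section
/- Let t ≥ 1 and let R be an associative ring with 1 satisfying the polynomial identity [[x₁,y₁],z₁]·[[x₂,y₂],z₂]⋯[[x_t,y_t],z_t] = 0 (for all substitutions of elements of R). Then the double commutator ideal D = R[[R,R],R]R satisfies D^t = {0}; that is, for any elements d₁, …, d_t ∈ D, the product d₁d₂⋯d_t equals 0. -/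
section DoubleCommutator

variable {R : Type*} [Ring R]

/-- The additive subgroup `[[R,R],R]`, as a `ℤ`-submodule. -/
def doubleCommutatorSpan (R : Type*) [Ring R] : Submodule ℤ R :=
  Submodule.span ℤ {u | ∃ a b c : R, u = (a * b - b * a) * c - c * (a * b - b * a)}

theorem mul_sub_mul_mem_doubleCommutatorSpan {v : R} (hv : v ∈ doubleCommutatorSpan R) (r : R) :
    v * r - r * v ∈ doubleCommutatorSpan R := by
  induction hv using Submodule.span_induction with
  | mem u hu =>
    obtain ⟨a, b, c, rfl⟩ := hu
    exact Submodule.subset_span ⟨a * b - b * a, c, r, rfl⟩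
  | zero => simp
  | add u w _ _ hu hw =>
    have h : (u + w) * r - r * (u + w) = (u * r - r * u) + (w * r - r * w) := by noncomm_ring
    exact h ▸ add_mem hu hw
  | smul n u _ hu =>
    have h : (n • u) * r - r * (n • u) = n • (u * r - r * u) := by
      rw [smul_mul_assoc, mul_smul_comm, smul_sub]
    exact h ▸ Submodule.smul_mem _ n hu

theorem doubleCommutatorSpan_mul_top_le :
    doubleCommutatorSpan R * ⊤ ≤ ⊤ * doubleCommutatorSpan R := by
  refine Submodule.mul_le.2 fun v hv r _ => ?_
  have h : v * r = 1 * (v * r - r * v) + r * v := by noncomm_ring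
  rw [h]
  exact add_mem
    (Submodule.mul_mem_mul trivial (mul_sub_mul_mem_doubleCommutatorSpan hv r))
    (Submodule.mul_mem_mul trivial hv)

theorem top_mul_doubleCommutatorSpan_pow_le (n : ℕ) :
    (⊤ * doubleCommutatorSpan R) ^ n ≤ ⊤ * doubleCommutatorSpan R ^ n := by
  induction n with
  | zero => simp
  | succ n ih =>
    calc (⊤ * doubleCommutatorSpan R) ^ (n + 1)
        = ⊤ * doubleCommutatorSpan R * (⊤ * doubleCommutatorSpan R) ^ n := pow_succ' _ _
      _ ≤ ⊤ * doubleCommutatorSpan R * (⊤ * doubleCommutatorSpan R ^ n) := by gcongr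
      _ = ⊤ * (doubleCommutatorSpan R * ⊤) * doubleCommutatorSpan R ^ n := by
        simp only [mul_assoc]
      _ ≤ ⊤ * (⊤ * doubleCommutatorSpan R) * doubleCommutatorSpan R ^ n := by
        gcongr ⊤ * ?_ * _
        exact doubleCommutatorSpan_mul_top_le
      _ = (⊤ * ⊤) * doubleCommutatorSpan R ^ (n + 1) := by
        simp only [mul_assoc, pow_succ']
      _ ≤ ⊤ * doubleCommutatorSpan R ^ (n + 1) := by
        gcongr
        exact le_top

theorem mem_top_mul_doubleCommutatorSpan_of_mem_span {x : R}
    (hx : x ∈ TwoSidedIdeal.span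
      {u : R | ∃ a b c : R, u = (a * b - b * a) * c - c * (a * b - b * a)}) :
    x ∈ ⊤ * doubleCommutatorSpan R := by
  have absorb : (⊤ : Submodule ℤ R) * ⊤ * doubleCommutatorSpan R ≤ ⊤ * doubleCommutatorSpan R :=
    mul_le_mul_left le_top _
  have left {r y : R} (hy : y ∈ ⊤ * doubleCommutatorSpan R) :
      r * y ∈ ⊤ * doubleCommutatorSpan R := by
    have h := Submodule.mul_mem_mul (Submodule.mem_top (R := ℤ) (x := r)) hy
    rw [← mul_assoc] at h
    exact absorb h
  have right {y r : R} (hy : y ∈ ⊤ * doubleCommutatorSpan R) :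
      y * r ∈ ⊤ * doubleCommutatorSpan R := by
    have h := Submodule.mul_mem_mul hy (Submodule.mem_top (R := ℤ) (x := r))
    rw [mul_assoc] at h
    have h' := (mul_le_mul_right doubleCommutatorSpan_mul_top_le _ : _ ≤ _) h
    rw [← mul_assoc] at h'
    exact absorb h'
  let I : TwoSidedIdeal R := TwoSidedIdeal.mk' (⊤ * doubleCommutatorSpan R : Submodule ℤ R)
    (zero_mem _) add_mem neg_mem left right
  have hI : x ∈ I := TwoSidedIdeal.mem_span_iff.1 hx I fun u hu => by
    rw [SetLike.mem_coe, TwoSidedIdeal.mem_mk']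
    have hu' : u ∈ doubleCommutatorSpan R := Submodule.subset_span hu
    simpa using Submodule.mul_mem_mul (Submodule.mem_top (R := ℤ) (x := (1 : R))) hu'
  rwa [TwoSidedIdeal.mem_mk'] at hI

theorem doubleCommutatorSpan_pow_eq_bot {t : ℕ}
    (hPI : ∀ x y z : ℕ → R,
      ((List.range t).map fun i =>
        (x i * y i - y i * x i) * z i - z i * (x i * y i - y i * x i)).prod = 0) :
    doubleCommutatorSpan R ^ t = ⊥ := by
  rw [doubleCommutatorSpan, Submodule.span_pow, Submodule.span_eq_bot]
  intro p hp
  obtain ⟨f, rfl⟩ := Set.mem_pow.1 hp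
  choose a b c h using fun i => (f i).2
  rw [← hPI (fun i => if hi : i < t then a ⟨i, hi⟩ else 0)
    (fun i => if hi : i < t then b ⟨i, hi⟩ else 0) (fun i => if hi : i < t then c ⟨i, hi⟩ else 0)]
  congr 1
  refine List.ext_getElem (by simp) fun i hi _ => ?_
  have hi' : i < t := by simpa using hi
  simp [hi', h]

theorem prod_map_range_mem_pow (V : Submodule ℤ R) (d : ℕ → R) (n : ℕ) (hd : ∀ i < n, d i ∈ V) :
    ((List.range n).map d).prod ∈ V ^ n := by
  induction n with
  | zero => simpa using (Submodule.one_le (P := (1 : Submodule ℤ R))).1 le_rfl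
  | succ n ih =>
    rw [List.range_succ, List.map_append, List.prod_append, pow_succ]
    exact Submodule.mul_mem_mul (ih fun i hi => hd i (by omega)) (by simpa using hd n (by omega))

end DoubleCommutator


/-- If `R` satisfies the polynomial identity
`[[x₁,y₁],z₁]·[[x₂,y₂],z₂]⋯[[x_t,y_t],z_t] = 0` (`t ≥ 1`), then the double commutator
ideal `D = R[[R,R],R]R` satisfies `D^t = {0}`: any product of `t` elements of `D`
vanishes. -/
theorem prod_mem_doubleCommutatorIdeal_eq_zero_of_PI
    (t : ℕ) (ht : 1 ≤ t) (R : Type*) [Ring R]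
    (hPI : ∀ x y z : ℕ → R,
      ((List.range t).map fun i =>
        (x i * y i - y i * x i) * z i - z i * (x i * y i - y i * x i)).prod = 0)
    (D : TwoSidedIdeal R)
    (hD : D = TwoSidedIdeal.span
      {u | ∃ a b c : R, u = (a * b - b * a) * c - c * (a * b - b * a)})
    (d : ℕ → R) (hd : ∀ i, i < t → d i ∈ D) :
    ((List.range t).map d).prod = 0 := by
  subst hD
  have h := top_mul_doubleCommutatorSpan_pow_le t <|
    prod_map_range_mem_pow _ d t fun i hi => mem_top_mul_doubleCommutatorSpan_of_mem_span (hd i hi)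
  rwa [doubleCommutatorSpan_pow_eq_bot hPI, Submodule.mul_bot, Submodule.mem_bot] at h
end

section
/- Let t ≥ 1, n ≥ 1, and let R be an associative ring with 1 satisfying the polynomial identity [x₁,y₁]·[x₂,y₂]⋯[x_t,y_t] = 0. Let A be an n×n matrix over R, let T = R[R,R]R be the commutator ideal (so that R/T is commutative), and let Ã be the image of A in Mₙ(R/T). Then for every choice of elements λ₀^{(1)}, λ₁^{(1)}, …, λₙ^{(1)} ∈ R whose images in R/T are n! times the corresponding coefficients of the classical characteristic polynomial det(x·Iₙ − Ã) ∈ (R/T)[x] (in particular λₙ^{(1)} may be taken to be n!), the identity ( Iₙ·λ₀^{(1)} + A·λ₁^{(1)} + ⋯ + A^{n−1}·λ_{n−1}^{(1)} + A^n·λₙ^{(1)} )^t = 0 holds, where A^i·λ denotes the product of A^i with the scalar matrix λ·Iₙ. -/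
/-- The determinant of a square matrix over a (possibly noncommutative) ring, given by
the Leibniz permutation-sum formula with ordered products; over a commutative ring (such
as the factor ring `R/T` below) this coincides with the classical determinant. -/
def detPerm {S : Type*} [Ring S] {m : ℕ} (M : Matrix (Fin m) (Fin m) S) : S :=
  ∑ σ : Equiv.Perm (Fin m),
    ((Equiv.Perm.sign σ : ℤˣ) : ℤ) • (List.ofFn fun i => M (σ i) i).prod

open Matrix Polynomial in
theorem detPerm_charmatrix_eq_charpoly {S : Type*} [CommRing S] {n : ℕ}
    (M : Matrix (Fin n) (Fin n) S) :
    detPerm ((X : S[X]) • (1 : Matrix (Fin n) (Fin n) S[X]) - M.map C) = M.charpoly := by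
  have h : (X : S[X]) • (1 : Matrix (Fin n) (Fin n) S[X]) - M.map C = M.charmatrix := by
    ext1 i j
    simp [charmatrix, Matrix.smul_one_eq_diagonal]
  rw [h, charpoly, det_apply, detPerm]
  simp [List.prod_ofFn, Units.smul_def]

open Polynomial in
theorem sum_pow_mul_smul_coeff_detPerm_eq_zero {S : Type*} [CommRing S] {n : ℕ}
    (M : Matrix (Fin n) (Fin n) S) (c : S) :
    ∑ i ∈ Finset.range (n + 1), M ^ i *
      ((c * (detPerm ((X : S[X]) • (1 : Matrix (Fin n) (Fin n) S[X]) - M.map C)).coeff i) •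
        (1 : Matrix (Fin n) (Fin n) S)) = 0 := by
  nontriviality S
  have hdeg : M.charpoly.natDegree < n + 1 := by simp [M.charpoly_natDegree_eq_dim]
  have h := M.aeval_self_charpoly
  rw [aeval_eq_sum_range' hdeg] at h
  simp_rw [detPerm_charmatrix_eq_charpoly, mul_smul_comm, mul_one, mul_smul,
    ← Finset.smul_sum, h, smul_zero]

/-- `sum_pow_mul_smul_coeff_detPerm_eq_zero` with commutativity as a hypothesis. -/
theorem sum_pow_mul_smul_coeff_detPerm_eq_zero_of_mul_comm {S : Type*} [inst : Ring S]
    (hcomm : ∀ a b : S, a * b = b * a) {n : ℕ} (M : Matrix (Fin n) (Fin n) S) (c : S) :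
    ∑ i ∈ Finset.range (n + 1), M ^ i *
      ((c * (detPerm ((Polynomial.X : Polynomial S) •
        (1 : Matrix (Fin n) (Fin n) (Polynomial S)) - M.map Polynomial.C)).coeff i) •
        (1 : Matrix (Fin n) (Fin n) S)) = 0 :=
  letI : CommRing S := { inst with mul_comm := hcomm }
  sum_pow_mul_smul_coeff_detPerm_eq_zero M c

/-- The left ideal generated by all products of `k` additive commutators. -/
def commutatorProductIdeal (R : Type*) [Ring R] (k : ℕ) : Submodule R R :=
  Submodule.span R {p | ∃ x y : ℕ → R,
    p = ((List.range k).map fun i => x i * y i - y i * x i).prod}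

theorem commutator_mul_mem_commutatorProductIdeal_succ {R : Type*} [Ring R] (a b : R)
    {k : ℕ} {p : R}
    (hp : ∃ x y : ℕ → R, p = ((List.range k).map fun i => x i * y i - y i * x i).prod) :
    (a * b - b * a) * p ∈ commutatorProductIdeal R (k + 1) := by
  obtain ⟨x, y, rfl⟩ := hp
  refine Submodule.subset_span ⟨fun i => Nat.casesOn i a x, fun i => Nat.casesOn i b y, ?_⟩
  simp [List.range_succ_eq_map, Function.comp_def]

theorem mul_mem_span_commutators {R : Type*} [Ring R] {u : R}
    (hu : u ∈ Submodule.span R {u | ∃ a b : R, u = a * b - b * a}) (r : R) :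
    u * r ∈ Submodule.span R {u | ∃ a b : R, u = a * b - b * a} := by
  induction hu using Submodule.span_induction with
  | mem u hu =>
    obtain ⟨a, b, rfl⟩ := hu
    have h : (a * b - b * a) * r = (a * (b * r) - (b * r) * a) - b • (a * r - r * a) := by
      simp only [smul_eq_mul]; noncomm_ring
    rw [h]
    exact sub_mem (Submodule.subset_span ⟨_, _, rfl⟩)
      (Submodule.smul_mem _ _ (Submodule.subset_span ⟨_, _, rfl⟩))
  | zero => simp
  | add u v _ _ hu hv => rw [add_mul]; exact add_mem hu hv
  | smul s u _ hu => rw [smul_mul_assoc]; exact Submodule.smul_mem _ _ hu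

theorem mem_span_commutators_of_mem_twoSidedIdeal_span {R : Type*} [Ring R] {u : R}
    (hu : u ∈ TwoSidedIdeal.span {u : R | ∃ a b : R, u = a * b - b * a}) :
    u ∈ Submodule.span R {u : R | ∃ a b : R, u = a * b - b * a} := by
  rw [TwoSidedIdeal.mem_span_iff] at hu
  let N := Submodule.span R {u : R | ∃ a b : R, u = a * b - b * a}
  simpa using hu (TwoSidedIdeal.mk' N N.zero_mem N.add_mem N.neg_mem
    (fun h => N.smul_mem _ h) (fun h => mul_mem_span_commutators h _))
    (fun v hv => by simpa using Submodule.subset_span hv)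

theorem mul_mem_commutatorProductIdeal_succ {R : Type*} [Ring R] {u p : R} {k : ℕ}
    (hu : u ∈ Submodule.span R {u : R | ∃ a b : R, u = a * b - b * a})
    (hp : p ∈ commutatorProductIdeal R k) : u * p ∈ commutatorProductIdeal R (k + 1) := by
  induction hp using Submodule.span_induction generalizing u with
  | mem p hp =>
    induction hu using Submodule.span_induction with
    | mem u hu =>
      obtain ⟨a, b, rfl⟩ := hu
      exact commutator_mul_mem_commutatorProductIdeal_succ a b hp
    | zero => simp
    | add u v _ _ hu hv => rw [add_mul]; exact add_mem hu hv
    | smul s u _ hu => rw [smul_mul_assoc]; exact Submodule.smul_mem _ _ hu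
  | zero => simp
  | add p q _ _ hp hq => rw [mul_add]; exact add_mem (hp hu) (hq hu)
  | smul s p _ hp =>
    rw [smul_eq_mul, ← mul_assoc]
    exact hp (mul_mem_span_commutators hu s)

theorem pow_apply_mem_commutatorProductIdeal {R ι : Type*} [Ring R] [Fintype ι] [DecidableEq ι]
    {B : Matrix ι ι R}
    (hB : ∀ i j, B i j ∈ Submodule.span R {u : R | ∃ a b : R, u = a * b - b * a})
    (k : ℕ) (i j : ι) : (B ^ k) i j ∈ commutatorProductIdeal R k := by
  induction k generalizing i j with
  | zero =>
    have h : (1 : R) ∈ commutatorProductIdeal R 0 := Submodule.subset_span ⟨0, 0, by simp⟩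
    simpa only [smul_eq_mul, mul_one] using Submodule.smul_mem _ ((B ^ 0) i j) h
  | succ k ih =>
    rw [pow_succ', Matrix.mul_apply]
    exact Submodule.sum_mem _ fun l _ => mul_mem_commutatorProductIdeal_succ (hB i l) (ih l j)

/-- **Power Cayley–Hamilton identity for rings with `[x₁,y₁]⋯[x_t,y_t] = 0`.**
Let `R` satisfy `[x₁,y₁]·[x₂,y₂]⋯[x_t,y_t] = 0` (`t ≥ 1`), let `A` be an `n×n` matrix
over `R` (`n ≥ 1`), let `T = R[R,R]R` be the commutator ideal (so `R/T` is commutative)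
and `Ã` the image of `A` over `R/T`. If the images in `R/T` of `λ₀,…,λₙ ∈ R` are `n!`
times the corresponding coefficients of the classical characteristic polynomial
`det(x·Iₙ − Ã)`, then `(Iₙλ₀ + Aλ₁ + ⋯ + A^nλₙ)^t = 0`. -/
theorem power_cayleyHamilton_of_commutator_PI
    (t n : ℕ) (ht : 1 ≤ t) (hn : 1 ≤ n) (R : Type*) [Ring R]
    (hPI : ∀ x y : ℕ → R,
      ((List.range t).map fun i => x i * y i - y i * x i).prod = 0)
    (A : Matrix (Fin n) (Fin n) R)
    (T : TwoSidedIdeal R)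
    (hT : T = TwoSidedIdeal.span {u | ∃ a b : R, u = a * b - b * a})
    (lam : ℕ → R)
    (hlam : ∀ i, i ≤ n →
      T.ringCon.mk' (lam i) =
        (Nat.factorial n : T.ringCon.Quotient) *
          (detPerm ((Polynomial.X : Polynomial T.ringCon.Quotient) •
              (1 : Matrix (Fin n) (Fin n) (Polynomial T.ringCon.Quotient)) -
            (A.map T.ringCon.mk').map Polynomial.C)).coeff i) :
    (∑ i ∈ Finset.range (n + 1),
      A ^ i * (lam i • (1 : Matrix (Fin n) (Fin n) R))) ^ t = 0 := by
  have hT0 : ∀ u : R, T.ringCon.mk' u = 0 ↔ u ∈ T := fun u => by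
    rw [← map_zero T.ringCon.mk', TwoSidedIdeal.mem_iff]
    exact RingCon.eq T.ringCon
  have hcomm : ∀ a b : T.ringCon.Quotient, a * b = b * a := by
    intro a b
    obtain ⟨a, rfl⟩ := T.ringCon.mk'_surjective a
    obtain ⟨b, rfl⟩ := T.ringCon.mk'_surjective b
    rw [← sub_eq_zero, ← map_mul, ← map_mul, ← map_sub, hT0, hT]
    exact TwoSidedIdeal.subset_span ⟨a, b, rfl⟩
  have hmap : (∑ i ∈ Finset.range (n + 1),
      A ^ i * (lam i • (1 : Matrix (Fin n) (Fin n) R))).map T.ringCon.mk' = 0 := by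
    rw [← sum_pow_mul_smul_coeff_detPerm_eq_zero_of_mul_comm hcomm (A.map T.ringCon.mk')
      (Nat.factorial n : T.ringCon.Quotient)]
    change T.ringCon.mk'.mapMatrix _ = _
    rw [map_sum]
    refine Finset.sum_congr rfl fun i hi => ?_
    rw [← hlam i (Nat.lt_succ_iff.mp (Finset.mem_range.mp hi)), map_mul, map_pow]
    congr 1
    ext k l
    by_cases h : k = l <;> simp [h]
  ext i j
  have hmem := pow_apply_mem_commutatorProductIdeal (fun k l =>
    mem_span_commutators_of_mem_twoSidedIdeal_span
      (hT ▸ (hT0 _).1 (congrFun (congrFun hmap k) l))) t i j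
  have hbot : commutatorProductIdeal R t = ⊥ := by
    rw [commutatorProductIdeal, Submodule.span_eq_bot]
    rintro _ ⟨x, y, rfl⟩
    exact hPI x y
  simpa [hbot] using hmem
end
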